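/- Let n ≥ 3 and k ≥ 0. If R is a maximal reversible set of critical pairs of S_n^k which is not a canonical reversible set, then n ≤ k and |R| ≤ (k+1)(k+2)/2 − n(n−1)/2 + 1. In particular, if n > k, every maximal reversible set is canonical. -/

import Mathlib

namespace CrownPaper

/-- Indices of the crown `S_n^k` live in `ZMod (n+k)`. The minimal element `a_i` is
incomparable to the maximal element `b_j` iff `(j - i) mod (n+k) ≤ k`. -/
def Incomp (n k : ℕ) (i j : ZMod (n + k)) : Prop := (j - i).val ≤ k

/-- `a_i < b_j` in the crown `S_n^k` iff `(j - i) mod (n+k) > k`. -/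
def CompLt (n k : ℕ) (i j : ZMod (n + k)) : Prop := k < (j - i).val

/-- A pair `(a_i, b_j)` is recorded as its pair of indices. -/
abbrev Pair (n k : ℕ) := ZMod (n + k) × ZMod (n + k)

/-- `(a_i, b_j)` is an incomparable (critical) pair. -/
def IsIncPair (n k : ℕ) (p : Pair n k) : Prop := Incomp n k p.1 p.2

/-- Adjacency in the graph `G_n^k` of critical pairs: `(a_i,b_j)` and `(a_p,b_q)` are
adjacent iff `a_i < b_q` and `a_p < b_j` in `S_n^k`. -/
def Adj (n k : ℕ) (p q : Pair n k) : Prop :=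
  CompLt n k p.1 q.2 ∧ CompLt n k q.1 p.2

/-- An independent set of critical pairs in `G_n^k`. -/
def Indep (n k : ℕ) (S : Set (Pair n k)) : Prop :=
  (∀ p ∈ S, IsIncPair n k p) ∧ ∀ p ∈ S, ∀ q ∈ S, ¬ Adj n k p q

/-- A set of pairs is reversible when some linear extension of the crown (encoded as an
injective map into `ℕ` on the disjoint union `A ⊕ B` preserving all strict comparabilities
`a_i < b_j`) puts `a` above `b` for every pair `(a,b)` of the set. -/
def Reversible (n k : ℕ) (S : Set (Pair n k)) : Prop :=
  ∃ f : (ZMod (n + k)) ⊕ (ZMod (n + k)) → ℕ,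
    Function.Injective f ∧
    (∀ i j : ZMod (n + k), CompLt n k i j → f (Sum.inl i) < f (Sum.inr j)) ∧
    ∀ p ∈ S, f (Sum.inr p.2) < f (Sum.inl p.1)

/-- A subset of the minimal elements (indices) is contiguous when it is a cyclic interval. -/
def Contiguous (n k : ℕ) (X : Set (ZMod (n + k))) : Prop :=
  ∃ (s : ZMod (n + k)) (r : ℕ), X = (fun t : ℕ => s + (t : ZMod (n + k))) '' {t | t < r}

/-- An `h`-contiguous sequence of `k+1` distinct minimal elements: every initial segment
is contiguous. -/
def HContiguous (n k : ℕ) (σ : Fin (k + 1) → ZMod (n + k)) : Prop :=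
  Function.Injective σ ∧ ∀ i : Fin (k + 1), Contiguous n k (σ '' {j | j ≤ i})

/-- The canonical reversible set `T(σ)` associated with an `h`-contiguous sequence `σ`:
`(σ i, b) ∈ T(σ)` iff `(σ j, b)` is incomparable for every `j ≤ i`. -/
def Tset (n k : ℕ) (σ : Fin (k + 1) → ZMod (n + k)) : Set (Pair n k) :=
  {p | ∃ i : Fin (k + 1), p.1 = σ i ∧ ∀ j : Fin (k + 1), j ≤ i → Incomp n k (σ j) p.2}

/-- A canonical reversible set is one of the form `T(σ)` for an `h`-contiguous `σ`. -/
def Canonical (n k : ℕ) (R : Set (Pair n k)) : Prop :=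
  ∃ σ : Fin (k + 1) → ZMod (n + k), HContiguous n k σ ∧ R = Tset n k σ


theorem not_incomp_iff (n k : ℕ) (i j : ZMod (n + k)) : ¬ Incomp n k i j ↔ CompLt n k i j := by
  simp [Incomp, CompLt]

theorem cast_inj_of_lt {n k : ℕ} {s t : ℕ} (hs : s < n + k) (ht : t < n + k)
    (h : (s : ZMod (n + k)) = t) : s = t := by
  have := (ZMod.natCast_eq_natCast_iff' s t (n + k)).1 h
  rwa [Nat.mod_eq_of_lt hs, Nat.mod_eq_of_lt ht] at this

theorem incomp_of {n k : ℕ} (hn : 3 ≤ n) {i j : ZMod (n + k)} (t : ℕ) (ht : t ≤ k)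
    (h : j = i + t) : Incomp n k i j := by
  subst h
  unfold Incomp
  rw [add_sub_cancel_left, ZMod.val_natCast_of_lt (by omega)]
  exact ht

theorem exists_of_incomp {n k : ℕ} (hn : 3 ≤ n) {i j : ZMod (n + k)} (h : Incomp n k i j) :
    ∃ t : ℕ, t ≤ k ∧ j = i + t := by
  have : NeZero (n + k) := ⟨by omega⟩
  refine ⟨(j - i).val, h, ?_⟩
  rw [ZMod.natCast_zmod_val]; ring

theorem cast_nk (n k : ℕ) : (n : ZMod (n + k)) + (k : ZMod (n + k)) = 0 := by
  have := ZMod.natCast_self (n + k)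
  push_cast at this
  exact this

theorem compLt_of {n k : ℕ} (hn : 3 ≤ n) {i j : ZMod (n + k)} (t : ℕ) (h1 : 1 ≤ t)
    (ht : t < n) (h : i = j + t) : CompLt n k i j := by
  have : j - i = ((n + k - t : ℕ) : ZMod (n + k)) := by
    subst h
    rw [Nat.cast_sub (by omega)]
    push_cast
    rw [cast_nk]; ring
  unfold CompLt
  rw [this, ZMod.val_natCast_of_lt (by omega)]
  omega

theorem exists_of_compLt {n k : ℕ} (hn : 3 ≤ n) {i j : ZMod (n + k)} (h : CompLt n k i j) :
    ∃ t : ℕ, 1 ≤ t ∧ t < n ∧ i = j + t := by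
  have : NeZero (n + k) := ⟨by omega⟩
  have hlt := ZMod.val_lt (j - i)
  unfold CompLt at h
  refine ⟨n + k - (j - i).val, by omega, by omega, ?_⟩
  rw [Nat.cast_sub (by omega), ZMod.natCast_zmod_val]
  push_cast
  rw [cast_nk]; ring

open Classical in
/-- Elements `b` incomparable to every element of `X`. -/
noncomputable def CC (n k : ℕ) [NeZero (n + k)] (X : Finset (ZMod (n + k))) :
    Finset (ZMod (n + k)) :=
  Finset.univ.filter (fun b => ∀ a ∈ X, Incomp n k a b)

/-- Right ends of the cyclic runs. -/
def Ends {n k : ℕ} (C : Finset (ZMod (n + k))) : Finset (ZMod (n + k)) :=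
  C.filter (fun b => b + 1 ∉ C)

theorem mem_CC {n k : ℕ} [NeZero (n + k)] {X : Finset (ZMod (n + k))} {b : ZMod (n + k)} :
    b ∈ CC n k X ↔ ∀ a ∈ X, Incomp n k a b := by
  simp [CC]

theorem F1 {n k : ℕ} (hn : 3 ≤ n) [NeZero (n + k)] {X : Finset (ZMod (n + k))}
    {b : ZMod (n + k)} (hb : b ∈ CC n k X) (t : ℕ) (h1 : 1 ≤ t) (ht : t < n) :
    b + (t : ZMod (n + k)) ∉ X := by
  intro hx
  have := mem_CC.1 hb _ hx
  exact (not_incomp_iff n k _ _).2 (compLt_of hn t h1 ht rfl) this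

theorem F2 {n k : ℕ} (hn : 3 ≤ n) [NeZero (n + k)] {X : Finset (ZMod (n + k))}
    {e : ZMod (n + k)} (he : e ∈ Ends (CC n k X)) :
    e + (n : ZMod (n + k)) ∈ X := by
  obtain ⟨he, he'⟩ := Finset.mem_filter.1 he
  rw [mem_CC] at he'
  push Not at he'
  obtain ⟨a, ha, hi⟩ := he'
  rw [not_incomp_iff] at hi
  obtain ⟨t, h1, h2, h3⟩ := exists_of_compLt hn hi
  have h4 : a = e + ((t + 1 : ℕ) : ZMod (n + k)) := by rw [h3]; push_cast; ring
  by_cases h : t + 1 < n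
  · exact absurd (h4 ▸ ha) (F1 hn he (t + 1) (by omega) h)
  · have : t + 1 = n := by omega
    rw [this] at h4
    exact h4 ▸ ha

theorem F3 {n k : ℕ} (hn : 3 ≤ n) [NeZero (n + k)] {X : Finset (ZMod (n + k))}
    {e : ZMod (n + k)} (he : e ∈ Ends (CC n k X)) (t : ℕ) (h1 : 1 ≤ t) (ht : t < n) :
    e + (t : ZMod (n + k)) ∉ CC n k X := by
  intro h
  refine F1 hn h (n - t) (by omega) (by omega) ?_
  have := F2 hn he
  rw [Nat.cast_sub (by omega)]
  convert this using 1
  ring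

theorem card_CC {n k : ℕ} (hn : 3 ≤ n) [NeZero (n + k)] (X : Finset (ZMod (n + k))) :
    (CC n k X).card + (n - 2) * (Ends (CC n k X)).card + X.card ≤ n + k := by
  classical
  set C := CC n k X with hC
  set A1 := C.image (fun b => b + 1) with hA1
  set A2 := (Ends C ×ˢ Finset.Ico 2 n).image (fun p => p.1 + (p.2 : ZMod (n + k))) with hA2
  have c1 : A1.card = C.card := Finset.card_image_of_injective _ (add_left_injective 1)
  have aux : ∀ e ∈ Ends C, ∀ e' ∈ Ends C, ∀ t t' : ℕ, t < t' → t' < n →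
      e + (t : ZMod (n + k)) = e' + (t' : ZMod (n + k)) → False := by
    intro e he e' he' t t' h h2 h3
    refine F3 hn he' (t' - t) (by omega) (by omega) ?_
    have : e = e' + ((t' - t : ℕ) : ZMod (n + k)) := by
      rw [Nat.cast_sub h.le]
      linear_combination h3
    rw [← this]
    exact (Finset.mem_filter.1 he).1
  have c2 : A2.card = (n - 2) * (Ends C).card := by
    rw [hA2, Finset.card_image_of_injOn, Finset.card_product, Nat.card_Ico, mul_comm]
    rintro ⟨e, t⟩ h ⟨e', t'⟩ h' heq
    simp only [Finset.coe_product, Set.mem_prod, Finset.mem_coe, Finset.mem_Ico] at h h'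
    simp only at heq
    rcases lt_trichotomy t t' with hlt | hlt | hlt
    · exact (aux e h.1 e' h'.1 t t' hlt h'.2.2 heq).elim
    · subst hlt
      simpa using heq
    · exact (aux e' h'.1 e h.1 t' t hlt h.2.2 heq.symm).elim
  have d1 : Disjoint A1 A2 := by
    rw [Finset.disjoint_left]
    intro y hy hy'
    obtain ⟨c, hc, rfl⟩ := Finset.mem_image.1 hy
    obtain ⟨⟨e, t⟩, h, heq⟩ := Finset.mem_image.1 hy'
    simp only [Finset.mem_product, Finset.mem_Ico] at h heq
    refine F3 hn h.1 (t - 1) (by omega) (by omega) ?_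
    have : e + ((t - 1 : ℕ) : ZMod (n + k)) = c := by
      rw [Nat.cast_sub (by omega)]
      push_cast
      linear_combination heq
    rw [this]; exact hc
  have d2 : Disjoint (A1 ∪ A2) X := by
    rw [Finset.disjoint_left]
    intro y hy
    rcases Finset.mem_union.1 hy with hy | hy
    · obtain ⟨c, hc, rfl⟩ := Finset.mem_image.1 hy
      have := F1 hn hc 1 le_rfl (by omega)
      simpa using this
    · obtain ⟨⟨e, t⟩, h, rfl⟩ := Finset.mem_image.1 hy
      simp only [Finset.mem_product, Finset.mem_Ico] at h
      exact F1 hn (Finset.mem_filter.1 h.1).1 t (by omega) h.2.2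
  rw [← c1, ← c2, ← Finset.card_union_of_disjoint d1, ← Finset.card_union_of_disjoint d2]
  refine (Finset.card_le_univ _).trans ?_
  rw [ZMod.card]

theorem ends_nonempty {n k : ℕ} (hn : 3 ≤ n) [NeZero (n + k)] {X : Finset (ZMod (n + k))}
    (hX : X.Nonempty) (hC : (CC n k X).Nonempty) : (Ends (CC n k X)).Nonempty := by
  by_contra hne
  rw [Finset.not_nonempty_iff_eq_empty] at hne
  have step : ∀ b ∈ CC n k X, b + 1 ∈ CC n k X := by
    intro b hb
    by_contra h
    have : b ∈ Ends (CC n k X) := Finset.mem_filter.2 ⟨hb, h⟩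
    rw [hne] at this
    simp at this
  obtain ⟨b, hb⟩ := hC
  have all : ∀ t : ℕ, b + (t : ZMod (n + k)) ∈ CC n k X := by
    intro t
    induction t with
    | zero => simpa using hb
    | succ t ih =>
      have := step _ ih
      push_cast
      rwa [← add_assoc]
  obtain ⟨x, hx⟩ := hX
  have h := all (x - 1 - b).val
  rw [ZMod.natCast_zmod_val] at h
  have := F1 hn h 1 le_rfl (by omega)
  apply this
  convert hx using 1
  push_cast; ring

theorem reversible_of_height {n k : ℕ} (hn : 3 ≤ n) (H : ZMod (n + k) → ℕ) (S : Set (Pair n k))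
    (hS : ∀ p ∈ S, 0 < H p.1 ∧ ∀ a, CompLt n k a p.2 → H a < H p.1) : Reversible n k S := by
  classical
  have : NeZero (n + k) := ⟨by omega⟩
  let hb : ZMod (n + k) → ℕ := fun b =>
    (Finset.univ.filter (fun a => CompLt n k a b)).sup (fun a => 2 * H a) + 1
  let ht : ZMod (n + k) ⊕ ZMod (n + k) → ℕ := Sum.elim (fun a => 2 * H a) hb
  let vl : ZMod (n + k) ⊕ ZMod (n + k) → ℕ := Sum.elim ZMod.val ZMod.val
  have hvl : ∀ y, vl y < n + k := by rintro (y | y) <;> exact ZMod.val_lt y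
  have key : ∀ y z, ht y < ht z → ht y * (n + k) + vl y < ht z * (n + k) + vl z := by
    intro y z h
    have := hvl y
    have h2 := Nat.mul_le_mul_right (n + k) (Nat.succ_le_of_lt h)
    rw [Nat.succ_mul] at h2
    omega
  have even_sup : ∀ b, Even ((Finset.univ.filter (fun a => CompLt n k a b)).sup
      (fun a => 2 * H a)) := by
    intro b
    apply Finset.sup_induction
    · simp
    · intro a ha b hb
      rcases le_total a b with h | h
      · rwa [sup_eq_right.2 h]
      · rwa [sup_eq_left.2 h]
    · intro a _
      exact even_two_mul _
  refine ⟨fun y => ht y * (n + k) + vl y, ?_, ?_, ?_⟩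
  · intro y z h
    simp only at h
    have h1 : ht y = ht z := by
      rcases lt_trichotomy (ht y) (ht z) with hh | hh | hh
      · have := key _ _ hh; omega
      · exact hh
      · have := key _ _ hh; omega
    have h2 : vl y = vl z := by rw [h1] at h; omega
    rcases y with y | y <;> rcases z with z | z
    · exact congrArg _ (ZMod.val_injective (n + k) h2)
    · exfalso
      obtain ⟨c, hc⟩ := even_sup z
      simp only [ht, hb, Sum.elim_inl, Sum.elim_inr] at h1
      omega
    · exfalso
      obtain ⟨c, hc⟩ := even_sup y
      simp only [ht, hb, Sum.elim_inl, Sum.elim_inr] at h1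
      omega
    · exact congrArg _ (ZMod.val_injective (n + k) h2)
  · intro i j hij
    apply key
    have : 2 * H i ≤ (Finset.univ.filter (fun a => CompLt n k a j)).sup (fun a => 2 * H a) :=
      Finset.le_sup (f := fun a => 2 * H a) (Finset.mem_filter.2 ⟨Finset.mem_univ _, hij⟩)
    simp only [ht, hb, Sum.elim_inl, Sum.elim_inr]
    omega
  · intro p hp
    apply key
    obtain ⟨h0, h1⟩ := hS p hp
    have : (Finset.univ.filter (fun a => CompLt n k a p.2)).sup (fun a => 2 * H a)
        ≤ 2 * H p.1 - 2 := by
      apply Finset.sup_le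
      intro a ha
      have := h1 a (Finset.mem_filter.1 ha).2
      omega
    simp only [ht, hb, Sum.elim_inl, Sum.elim_inr]
    omega

theorem reversible_Tset {n k : ℕ} (hn : 3 ≤ n) (σ : Fin (k + 1) → ZMod (n + k))
    (hσ : Function.Injective σ) : Reversible n k (Tset n k σ) := by
  classical
  let H : ZMod (n + k) → ℕ := fun a =>
    if h : ∃ i, a = σ i then k + 1 - (h.choose : Fin (k + 1)).val else 0
  have H1 : ∀ i, H (σ i) = k + 1 - i.val := by
    intro i
    have h : ∃ j, σ i = σ j := ⟨i, rfl⟩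
    have h2 : h.choose = i := (hσ h.choose_spec).symm
    simp only [H]
    rw [dif_pos h, h2]
  apply reversible_of_height hn H
  rintro ⟨a, b⟩ ⟨i, hi, hT⟩
  simp only at hi hT ⊢
  subst hi
  rw [H1]
  refine ⟨by omega, ?_⟩
  intro a ha
  by_cases h : ∃ j, a = σ j
  · obtain ⟨j, rfl⟩ := h
    rw [H1]
    have : ¬ j ≤ i := fun hji => (not_incomp_iff n k _ _).2 ha (hT j hji)
    have : i.val < j.val := by simpa using this
    omega
  · simp only [H]
    rw [dif_neg h]
    omega

theorem exists_path {α : Type*} (J : Finset α) (u v : α → ℕ)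
    (h : ∀ i ∈ J, ∀ j ∈ J, v j ≤ v i ∨ u i ≤ u j) :
    ∃ V : ℕ → ℕ, V 0 = 0 ∧ (∀ s, V s ≤ V (s + 1) ∧ V (s + 1) ≤ V s + 1) ∧
      ∀ i ∈ J, V (u i + v i) = v i := by
  refine ⟨fun s => J.sup (fun j => min (v j) (s - u j)), ?_, ?_, ?_⟩
  · simp
  · intro s
    refine ⟨Finset.sup_mono_fun fun j _ => by omega, ?_⟩
    apply Finset.sup_le
    intro j hj
    have := Finset.le_sup (f := fun j => min (v j) (s - u j)) hj
    beta_reduce at this ⊢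
    omega
  · intro i hi
    apply le_antisymm
    · apply Finset.sup_le
      intro j hj
      have := h i hi j hj
      omega
    · have := Finset.le_sup (f := fun j => min (v j) (u i + v i - u j)) hi
      beta_reduce at this ⊢
      omega

theorem exists_sigma {n k : ℕ} (hn : 3 ≤ n) (x : ZMod (n + k)) (V : ℕ → ℕ) (V0 : V 0 = 0)
    (hV : ∀ s, V s ≤ V (s + 1) ∧ V (s + 1) ≤ V s + 1) :
    ∃ σ : Fin (k + 1) → ZMod (n + k), HContiguous n k σ ∧
      ∀ (i : Fin (k + 1)) (y : ZMod (n + k)), (∃ j, j ≤ i ∧ σ j = y) ↔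
        ∃ t : ℕ, t ≤ i.val ∧ y = x - ((i.val - V i.val : ℕ) : ZMod (n + k)) + t := by
  classical
  have hVs : ∀ s, V s ≤ s := by
    intro s
    induction s with
    | zero => omega
    | succ s ih => have := hV s; omega
  let σ' : ℕ → ZMod (n + k) := fun s =>
    if V s = V (s - 1) then x - ((s - V s : ℕ) : ZMod (n + k)) else x + (V s : ZMod (n + k))
  have main : ∀ (s : ℕ) (y : ZMod (n + k)), (∃ j, j ≤ s ∧ σ' j = y) ↔
      ∃ t : ℕ, t ≤ s ∧ y = x - ((s - V s : ℕ) : ZMod (n + k)) + t := by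
    intro s
    induction s with
    | zero =>
      intro y
      simp [σ', V0, eq_comm]
    | succ s ih =>
      intro y
      have split : (∃ j, j ≤ s + 1 ∧ σ' j = y) ↔ ((∃ j, j ≤ s ∧ σ' j = y) ∨ σ' (s + 1) = y) := by
        constructor
        · rintro ⟨j, hj, h⟩
          rcases Nat.lt_or_ge s j with h' | h'
          · have : j = s + 1 := by omega
            subst this; exact Or.inr h
          · exact Or.inl ⟨j, h', h⟩
        · rintro (⟨j, hj, h⟩ | h)
          · exact ⟨j, by omega, h⟩
          · exact ⟨s + 1, le_rfl, h⟩
      rw [split, ih]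
      have hs := hVs s
      by_cases hc : V (s + 1) = V s
      · have e1 : σ' (s + 1) = x - ((s + 1 - V (s + 1) : ℕ) : ZMod (n + k)) := by
          simp [σ', hc]
        have e2 : ((s + 1 - V (s + 1) : ℕ) : ZMod (n + k))
            = ((s - V s : ℕ) : ZMod (n + k)) + 1 := by
          rw [hc, show s + 1 - V s = (s - V s) + 1 by omega]; push_cast; ring
        rw [e1, e2]
        constructor
        · rintro (⟨t, ht, rfl⟩ | rfl)
          · exact ⟨t + 1, by omega, by push_cast; ring⟩
          · exact ⟨0, by omega, by simp⟩
        · rintro ⟨t, ht, rfl⟩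
          rcases t with _ | t
          · right; simp
          · left; exact ⟨t, by omega, by push_cast; ring⟩
      · have hc' : V (s + 1) = V s + 1 := by have := hV s; omega
        have e1 : σ' (s + 1) = x + (V (s + 1) : ZMod (n + k)) := by
          simp [σ', hc]
        have e2 : s + 1 - V (s + 1) = s - V s := by omega
        have e3 : σ' (s + 1) = x - ((s - V s : ℕ) : ZMod (n + k)) + ((s + 1 : ℕ) : ZMod (n + k)) := by
          rw [e1, hc', Nat.cast_sub hs]; push_cast; ring
        rw [e2, e3]
        constructor
        · rintro (⟨t, ht, rfl⟩ | rfl)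
          · exact ⟨t, by omega, rfl⟩
          · exact ⟨s + 1, le_rfl, rfl⟩
        · rintro ⟨t, ht, rfl⟩
          rcases Nat.lt_or_ge s t with h' | h'
          · have : t = s + 1 := by omega
            subst this; exact Or.inr rfl
          · left; exact ⟨t, by omega, rfl⟩
  have main' : ∀ (i : Fin (k + 1)) (y : ZMod (n + k)), (∃ j : Fin (k + 1), j ≤ i ∧ σ' j.val = y) ↔
        ∃ t : ℕ, t ≤ i.val ∧ y = x - ((i.val - V i.val : ℕ) : ZMod (n + k)) + t := by
    intro i y
    rw [← main]
    constructor
    · rintro ⟨j, hj, h⟩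
      exact ⟨j.val, hj, h⟩
    · rintro ⟨j, hj, h⟩
      exact ⟨⟨j, by omega⟩, hj, h⟩
  refine ⟨fun i => σ' i.val, ⟨?_, ?_⟩, main'⟩
  · have hinj : Set.InjOn σ' (Finset.range (k + 1) : Finset ℕ) := by
      apply Finset.injOn_of_card_image_eq
      have : (Finset.range (k + 1)).image σ' = (Finset.range (k + 1)).image
          (fun t : ℕ => x - ((k - V k : ℕ) : ZMod (n + k)) + t) := by
        ext y
        have := main k y
        simp only [Finset.mem_image, Finset.mem_range, Nat.lt_succ_iff]
        rw [this]
        simp only [eq_comm]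
      rw [this]
      apply Finset.card_image_of_injOn
      intro s hs t ht h
      simp only [Finset.coe_range, Set.mem_Iio] at hs ht
      simp only [add_right_inj] at h
      exact cast_inj_of_lt (by omega) (by omega) h
    intro i j h
    apply Fin.ext
    exact hinj (by simp; omega) (by simp; omega) h
  · intro i
    refine ⟨x - ((i.val - V i.val : ℕ) : ZMod (n + k)), i.val + 1, ?_⟩
    ext y
    have := main' i y
    simp only [Set.mem_image, Set.mem_ofPred_eq]
    rw [this]
    simp only [Nat.lt_succ_iff, eq_comm]

/-- Elements at least as high as `a`. -/
def up {m : ℕ} [NeZero m] (g : ZMod m → ℕ) (a : ZMod m) : Finset (ZMod m) :=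
  Finset.univ.filter (fun a' => g a ≤ g a')

theorem mem_up {m : ℕ} [NeZero m] {g : ZMod m → ℕ} {a a' : ZMod m} :
    a' ∈ up g a ↔ g a ≤ g a' := by simp [up]

theorem exists_interval {n k : ℕ} (hn : 3 ≤ n) [NeZero (n + k)] (X : Finset (ZMod (n + k)))
    (x : ZMod (n + k)) (hx : x ∈ X) (hC : (CC n k X).Nonempty)
    (hends : (Ends (CC n k X)).card ≤ 1) :
    ∃ l r : ℕ, l ≤ r ∧ r ≤ k ∧ ∀ c : ℕ, c ≤ k → (x + (c : ZMod (n + k)) ∈ CC n k X ↔ l ≤ c ∧ c ≤ r) := by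
  classical
  set C := CC n k X with hCdef
  have hrep : ∀ b ∈ C, ∃ c : ℕ, c ≤ k ∧ b = x + c := fun b hb =>
    exists_of_incomp hn (mem_CC.1 hb x hx)
  set S := (Finset.range (k + 1)).filter (fun c : ℕ => x + (c : ZMod (n + k)) ∈ C) with hS
  have memS : ∀ c : ℕ, c ∈ S ↔ c ≤ k ∧ x + (c : ZMod (n + k)) ∈ C := by
    intro c; simp [hS, Nat.lt_succ_iff]
  have hSne : S.Nonempty := by
    obtain ⟨b, hb⟩ := hC
    obtain ⟨c, hc, rfl⟩ := hrep b hb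
    exact ⟨c, (memS c).2 ⟨hc, hb⟩⟩
  set l := S.min' hSne with hl
  set r := S.max' hSne with hr
  have lS := (memS l).1 (S.min'_mem hSne)
  have rS := (memS r).1 (S.max'_mem hSne)
  refine ⟨l, r, S.min'_le _ (S.max'_mem hSne), rS.1, ?_⟩
  intro c hck
  constructor
  · intro h
    have : c ∈ S := (memS c).2 ⟨hck, h⟩
    exact ⟨S.min'_le _ this, S.le_max' _ this⟩
  · rintro ⟨hlc, hcr⟩
    by_contra hc
    let P : ℕ → Prop := fun t => x + (t : ZMod (n + k)) ∈ C
    set e1 := Nat.findGreatest P c with he1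
    have h1 : P e1 := Nat.findGreatest_spec (P := P) hlc lS.2
    have h2 : e1 ≤ c := Nat.findGreatest_le c
    have h3 : e1 ≠ c := by
      intro h; rw [h] at h1; exact hc h1
    have h4 : ¬ P (e1 + 1) := Nat.findGreatest_is_greatest (Nat.lt_succ_self _) (by omega)
    have end1 : x + (e1 : ZMod (n + k)) ∈ Ends C := by
      refine Finset.mem_filter.2 ⟨h1, ?_⟩
      intro h; apply h4
      simp only [P]
      push_cast
      rwa [← add_assoc]
    have end2 : x + (r : ZMod (n + k)) ∈ Ends C := by
      refine Finset.mem_filter.2 ⟨rS.2, ?_⟩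
      intro h
      obtain ⟨c', hc', heq⟩ := hrep _ h
      have h5 : ((r + 1 : ℕ) : ZMod (n + k)) = c' := by
        push_cast
        linear_combination heq
      have h6 := cast_inj_of_lt (by omega) (by omega) h5
      have : c' ∈ S := (memS c').2 ⟨hc', heq ▸ h⟩
      have := S.le_max' _ this
      omega
    have h7 := Finset.card_le_one.1 hends _ end1 _ end2
    have h8 := cast_inj_of_lt (by omega) (by omega) (add_left_cancel h7)
    omega

theorem canonical_case {n k : ℕ} (hn : 3 ≤ n) [NeZero (n + k)] (g : ZMod (n + k) → ℕ)
    (hends : ∀ a, (Ends (CC n k (up g a))).card ≤ 1) :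
    ∃ σ : Fin (k + 1) → ZMod (n + k), HContiguous n k σ ∧
      ∀ a b, b ∈ CC n k (up g a) → ((a, b) : Pair n k) ∈ Tset n k σ := by
  classical
  obtain ⟨x, hx⟩ := Finite.exists_max g
  have hxu : ∀ a, x ∈ up g a := fun a => mem_up.2 (hx a)
  set J := Finset.univ.filter (fun a => (CC n k (up g a)).Nonempty) with hJ
  have hex : ∀ a, a ∈ J → ∃ l r : ℕ, l ≤ r ∧ r ≤ k ∧
      ∀ c : ℕ, c ≤ k → (x + (c : ZMod (n + k)) ∈ CC n k (up g a) ↔ l ≤ c ∧ c ≤ r) := by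
    intro a ha
    exact exists_interval hn _ x (hxu a) (Finset.mem_filter.1 ha).2 (hends a)
  choose! l r hlr hrk hlc using hex
  have mono : ∀ i ∈ J, ∀ j ∈ J, g i ≤ g j → l j ≤ l i ∧ r i ≤ r j := by
    intro i hi j hj h
    have sub : CC n k (up g i) ⊆ CC n k (up g j) := by
      intro b hb
      rw [mem_CC] at hb ⊢
      intro a ha
      exact hb a (mem_up.2 (h.trans (mem_up.1 ha)))
    have h1 := hlr i hi
    have h2 := hrk i hi
    have h3 := (hlc j hj (l i) (by omega)).1 (sub ((hlc i hi (l i) (by omega)).2 ⟨le_rfl, h1⟩))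
    have h4 := (hlc j hj (r i) (by omega)).1 (sub ((hlc i hi (r i) (by omega)).2 ⟨h1, le_rfl⟩))
    omega
  obtain ⟨V, V0, hV, hVJ⟩ := exists_path J (fun a => k - r a) l (by
    intro i hi j hj
    rcases le_total (g i) (g j) with h | h
    · left; exact (mono i hi j hj h).1
    · right; have := (mono j hj i hi h).2; omega)
  obtain ⟨σ, hσ, hmem⟩ := exists_sigma hn x V V0 hV
  refine ⟨σ, hσ, ?_⟩
  intro a b hb
  have haJ : a ∈ J := Finset.mem_filter.2 ⟨Finset.mem_univ _, ⟨b, hb⟩⟩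
  obtain ⟨c, hck, rfl⟩ := exists_of_incomp hn (mem_CC.1 hb x (hxu a))
  have hc := (hlc a haJ c hck).1 hb
  have h1 := hlr a haJ
  have h2 := hrk a haJ
  have h3 := hVJ a haJ
  let s : Fin (k + 1) := ⟨k - r a + l a, by omega⟩
  have hs : s.val - V s.val = k - r a := by simp only [s]; omega
  have haa : a ∈ up g a := mem_up.2 le_rfl
  have hpos : ∃ t : ℕ, t ≤ s.val ∧ a = x - ((s.val - V s.val : ℕ) : ZMod (n + k)) + t := by
    rw [hs]
    have hy : a = x + ((a - x).val : ZMod (n + k)) := by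
      rw [ZMod.natCast_zmod_val]; ring
    set y := (a - x).val with hydef
    have hylt : y < n + k := ZMod.val_lt _
    have hcases : y ≤ l a ∨ n + r a ≤ y := by
      by_contra hcon
      push Not at hcon
      by_cases hyr : y ≤ r a
      · have h5 := (hlc a haJ (y - 1) (by omega)).2 ⟨by omega, by omega⟩
        refine F1 hn h5 1 le_rfl (by omega) ?_
        rw [Nat.cast_sub (by omega)]
        convert haa using 1
        rw [hy]; push_cast; ring
      · have h5 := (hlc a haJ (r a) (by omega)).2 ⟨by omega, by omega⟩
        refine F1 hn h5 (y - r a) (by omega) (by omega) ?_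
        rw [Nat.cast_sub (by omega)]
        convert haa using 1
        rw [hy]; ring
    rcases hcases with h | h
    · refine ⟨k - r a + y, by simp only [s]; omega, ?_⟩
      rw [hy]; push_cast; ring
    · refine ⟨y - (n + r a), by simp only [s]; omega, ?_⟩
      rw [Nat.cast_sub h, Nat.cast_sub h2]
      push_cast
      linear_combination hy + cast_nk n k
  obtain ⟨i, his, hi⟩ := (hmem s a).2 hpos
  refine ⟨i, hi.symm, ?_⟩
  intro j hj
  obtain ⟨t, ht, htj⟩ := (hmem s (σ j)).1 ⟨j, hj.trans his, rfl⟩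
  rw [hs] at htj
  have ht' : t ≤ k - r a + l a := ht
  refine incomp_of hn (c + (k - r a) - t) (by omega) ?_
  rw [htj, Nat.cast_sub (show t ≤ c + (k - r a) by omega)]
  push_cast; ring

theorem exists_enum {m : ℕ} [NeZero m] (g : ZMod m → ℕ) (hg : Function.Injective g) :
    ∃ e : Fin m ≃ ZMod m, ∀ i j, g (e i) ≤ g (e j) ↔ j ≤ i := by
  let e0 : Fin m ≃ ZMod m := (Fintype.equivFinOfCardEq (ZMod.card m)).symm
  let h : Fin m → ℕᵒᵈ := fun i => OrderDual.toDual (g (e0 i))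
  let e : Fin m ≃ ZMod m := (Tuple.sort h).trans e0
  have hm : Monotone (h ∘ Tuple.sort h) := Tuple.monotone_sort h
  have hanti : ∀ i j, i ≤ j → g (e j) ≤ g (e i) := fun i j hij => hm hij
  refine ⟨e, fun i j => ⟨fun hle => ?_, fun hij => hanti j i hij⟩⟩
  by_contra hcon
  push Not at hcon
  have h1 := hanti i j hcon.le
  have := e.injective (hg (le_antisymm h1 hle))
  exact absurd this hcon.ne'

theorem sum_tri (K : ℕ) : ∀ d : ℕ, 2 * ∑ j ∈ Finset.range (K + d), (K - j) = K * (K + 1) := by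
  intro d
  induction d with
  | zero =>
    induction K with
    | zero => simp
    | succ K ih =>
      rw [add_zero, Finset.sum_range_succ']
      simp only [Nat.add_sub_add_right, add_zero, Nat.sub_zero] at ih ⊢
      rw [mul_add, ih]; ring
  | succ d ih =>
    rw [← add_assoc, Finset.sum_range_succ, show K - (K + d) = 0 by omega, add_zero, ih]

theorem sum_bound (n k i : ℕ) (hn : 3 ≤ n) (φ : ℕ → ℕ) (hik : n + i ≤ k + 1)
    (ha : ∀ j, φ j ≤ k + 1 - j) (hb : φ i + 2 * (n - 2) + (i + 1) ≤ n + k)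
    (hb2 : 2 ≤ φ i) (hc : ∀ j, i < j → φ j + 1 ≤ φ i) :
    ∑ j ∈ Finset.range (n + k), φ j + n * (n - 1) / 2 ≤ (k + 1) * (k + 2) / 2 + 1 := by
  let E : ℕ → ℕ := fun j => if j < i then 0 else if j = i then n - 2 else n - 1 - (j - i)
  have hle : ∀ j, φ j + E j ≤ k + 1 - j := by
    intro j
    have h1 := ha j
    have h2 := hc j
    simp only [E]
    split_ifs with h3 h4
    · omega
    · subst h4; omega
    · have := h2 (by omega)
      omega
  have hsum : ∑ j ∈ Finset.range (n + k), φ j + ∑ j ∈ Finset.range (n + k), E j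
      ≤ ∑ j ∈ Finset.range (n + k), (k + 1 - j) := by
    rw [← Finset.sum_add_distrib]
    exact Finset.sum_le_sum fun j _ => hle j
  have hK := sum_tri (k + 1) (n - 1)
  rw [show k + 1 + (n - 1) = n + k by omega] at hK
  obtain ⟨q, rfl⟩ : ∃ q, n = q + 2 := ⟨n - 2, by omega⟩
  have hE : ∑ j ∈ Finset.range (q + 2 + k), E j
      = q + ∑ j ∈ Finset.range (q + (k + 1 - i)), (q - j) := by
    rw [show q + 2 + k = i + ((q + (k + 1 - i)) + 1) by omega, Finset.sum_range_add,
      Finset.sum_range_succ']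
    have z : ∑ x ∈ Finset.range i, E x = 0 := by
      apply Finset.sum_eq_zero
      intro x hx
      simp [E, Finset.mem_range.1 hx]
    have y : E (i + 0) = q := by simp [E]
    have w : ∀ x, E (i + (x + 1)) = q - x := by
      intro x
      simp only [E]
      rw [if_neg (by omega), if_neg (by omega)]
      omega
    rw [z, y]
    simp only [w]
    omega
  have hq := sum_tri q (k + 1 - i)
  have e1 : (q + 2) * (q + 2 - 1) = q * (q + 1) + 2 * q + 2 := by
    rw [show q + 2 - 1 = q + 1 by omega]; ring
  rw [e1]
  have e2 : (k + 1) * (k + 1 + 1) = (k + 1) * (k + 2) := rfl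
  omega

theorem bound_case {n k : ℕ} (hn : 3 ≤ n) [NeZero (n + k)] (g : ZMod (n + k) → ℕ)
    (hg : Function.Injective g) (a0 : ZMod (n + k))
    (ha0 : 2 ≤ (Ends (CC n k (up g a0))).card) :
    n ≤ k ∧ ∑ a, (CC n k (up g a)).card + n * (n - 1) / 2 ≤ (k + 1) * (k + 2) / 2 + 1 := by
  classical
  obtain ⟨e, he⟩ := exists_enum g hg
  have hup : ∀ i, up g (e i) = (Finset.Iic i).image e := by
    intro i
    ext y
    obtain ⟨j, rfl⟩ := e.surjective y
    simp [mem_up, he]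
  have hcard : ∀ i : Fin (n + k), (up g (e i)).card = i.val + 1 := by
    intro i
    rw [hup, Finset.card_image_of_injective _ e.injective, Fin.card_Iic]
  let G : Fin (n + k) → Finset (ZMod (n + k)) := fun i => CC n k (up g (e i))
  have hG : ∀ i, (G i).card + (n - 2) * (Ends (G i)).card + (i.val + 1) ≤ n + k := by
    intro i
    rw [← hcard]
    exact card_CC hn _
  have hG1 : ∀ i, (G i).Nonempty → 1 ≤ (Ends (G i)).card := fun i h =>
    Finset.card_pos.2 (ends_nonempty hn ⟨e i, mem_up.2 le_rfl⟩ h)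
  let W := Finset.univ.filter (fun i => 2 ≤ (Ends (G i)).card)
  have hW : W.Nonempty := ⟨e.symm a0, by simpa [W, G] using ha0⟩
  obtain ⟨i, hi, himax⟩ := W.exists_max_image id hW
  have hi2 : 2 ≤ (Ends (G i)).card := (Finset.mem_filter.1 hi).2
  have hi0 : i.val ≠ 0 := by
    intro h0
    have h1 : (up g (e i)).card ≤ 1 := by rw [hcard, h0]
    obtain ⟨p, hp, q, hq, hpq⟩ := Finset.one_lt_card.1 (show 1 < (Ends (G i)).card by omega)
    exact hpq (add_right_cancel (Finset.card_le_one.1 h1 _ (F2 hn hp) _ (F2 hn hq)))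
  have hGi2 : 2 ≤ (G i).card := hi2.trans (Finset.card_le_card (Finset.filter_subset _ _))
  let φ : ℕ → ℕ := fun j => if h : j < n + k then (G ⟨j, h⟩).card else 0
  have hφ : ∀ j : Fin (n + k), φ j.val = (G j).card := by
    intro j
    simp [φ]
  have hsum : ∑ a, (CC n k (up g a)).card = ∑ j ∈ Finset.range (n + k), φ j := by
    rw [← Equiv.sum_comp e, ← Fin.sum_univ_eq_sum_range]
    exact Finset.sum_congr rfl fun j _ => (hφ j).symm
  have hb : φ i.val + 2 * (n - 2) + (i.val + 1) ≤ n + k := by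
    have h1 := hG i
    have h2 := Nat.mul_le_mul_left (n - 2) hi2
    rw [hφ]
    omega
  have hb2 : 2 ≤ φ i.val := by rw [hφ]; exact hGi2
  refine ⟨by omega, ?_⟩
  rw [hsum]
  refine sum_bound n k i.val hn φ (by omega) ?_ hb hb2 ?_
  · intro j
    by_cases h : j < n + k
    · have h0 := hφ ⟨j, h⟩
      simp only at h0
      rw [h0]
      rcases (G ⟨j, h⟩).eq_empty_or_nonempty with h1 | h1
      · simp [h1]
      · have h2 := Nat.mul_le_mul_left (n - 2) (hG1 _ h1)
        have h3 := hG ⟨j, h⟩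
        simp only at h3
        omega
    · simp [φ, h]
  · intro j hij
    by_cases h : j < n + k
    · have h0 := hφ ⟨j, h⟩
      simp only at h0
      rw [h0, hφ]
      apply Nat.succ_le_of_lt
      apply Finset.card_lt_card
      refine (Finset.ssubset_iff_subset_ne).2 ⟨?_, ?_⟩
      · intro b hb
        refine mem_CC.2 fun a ha => mem_CC.1 hb a (mem_up.2 (le_trans ?_ (mem_up.1 ha)))
        rw [he]
        exact Fin.le_def.2 hij.le
      · intro heq
        have : (⟨j, h⟩ : Fin (n + k)) ∈ W := by
          refine Finset.mem_filter.2 ⟨Finset.mem_univ _, ?_⟩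
          rw [heq]; exact hi2
        have := Fin.le_def.1 (himax _ this)
        simp only [id] at this
        omega
    · simp only [φ, h, dif_neg, not_false_eq_true]
      have := hb2
      simp only [φ] at this
      omega

/-- a maximal reversible set of critical pairs of `S_n^k` which is not
canonical forces `n ≤ k` and satisfies `|R| ≤ (k+1)(k+2)/2 − n(n−1)/2 + 1`; in
particular, for `n > k` every maximal reversible set is canonical. -/
theorem maximal_reversible_not_canonical (n k : ℕ) (hn : 3 ≤ n)
    (R : Set (Pair n k)) (hinc : ∀ p ∈ R, IsIncPair n k p)
    (hrev : Reversible n k R)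
    (hmax : ∀ R' : Set (Pair n k), R ⊆ R' → (∀ p ∈ R', IsIncPair n k p) →
      Reversible n k R' → R' = R)
    (hnc : ¬ Canonical n k R) :
    n ≤ k ∧ R.ncard + n * (n - 1) / 2 ≤ (k + 1) * (k + 2) / 2 + 1 := by
  classical
  have : NeZero (n + k) := ⟨by omega⟩
  obtain ⟨f, hf, hlt, hR⟩ := hrev
  let g : ZMod (n + k) → ℕ := fun a => f (Sum.inl a)
  have hg : Function.Injective g := fun a b h => Sum.inl_injective (hf h)
  have hRC : ∀ p ∈ R, p.2 ∈ CC n k (up g p.1) := by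
    intro p hp
    refine mem_CC.2 fun a ha => ?_
    by_contra h
    have h1 := hlt _ _ ((not_incomp_iff n k _ _).1 h)
    have h2 := hR p hp
    have h3 : f (Sum.inl p.1) ≤ f (Sum.inl a) := mem_up.1 ha
    omega
  by_cases hends : ∀ a, (Ends (CC n k (up g a))).card ≤ 1
  · exfalso
    obtain ⟨σ, hσ, hT⟩ := canonical_case hn g hends
    refine hnc ⟨σ, hσ, (hmax (Tset n k σ) ?_ ?_ (reversible_Tset hn σ hσ.1)).symm⟩
    · intro p hp
      exact hT p.1 p.2 (hRC p hp)
    · rintro p ⟨i, hi, hT⟩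
      have := hT i le_rfl
      rw [← hi] at this
      exact this
  · push Not at hends
    obtain ⟨a0, ha0⟩ := hends
    obtain ⟨h1, h2⟩ := bound_case hn g hg a0 ha0
    refine ⟨h1, le_trans (Nat.add_le_add_right ?_ _) h2⟩
    let T : Finset (Pair n k) := (Finset.univ.sigma (fun a => CC n k (up g a))).image
      (fun p => (p.1, p.2))
    have hsub : R ⊆ (T : Set (Pair n k)) := by
      intro p hp
      refine Finset.mem_coe.2 (Finset.mem_image.2 ⟨⟨p.1, p.2⟩, ?_, rfl⟩)
      exact Finset.mem_sigma.2 ⟨Finset.mem_univ _, hRC p hp⟩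
    calc R.ncard ≤ (T : Set (Pair n k)).ncard := Set.ncard_le_ncard hsub (Finset.finite_toSet T)
      _ = T.card := Set.ncard_coe_finset T
      _ ≤ _ := Finset.card_image_le
      _ = _ := Finset.card_sigma _ _

end CrownPaper
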